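/- arXiv:2110.14342 — 6 statements merged into one kernel-verified Lean document; each statement's English description precedes it below -/
import Mathlib

section
/- For every positive integer n and every nonzero complex number q, the discriminant of the q-metallic number is palindromic: q^{2n+2} * D_n(1/q) = D_n(q). -/
/-- The Euler `q`-integer `[n]_q = 1 + q + ⋯ + q^{n-1}`. -/
noncomputable def qint (n : ℕ) (q : ℂ) : ℂ := ∑ i ∈ Finset.range n, q ^ i

/-- The discriminant `D_n(q)` of the quadratic equation satisfied by
the `n`-th `q`-metallic number. -/
noncomputable def Dmet (n : ℕ) (q : ℂ) : ℂ :=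
  ((q - 1) * (q ^ n + 1) + q * qint n q) ^ 2 + 4 * q

theorem sub_one_mul_qint (n : ℕ) (q : ℂ) : (q - 1) * qint n q = q ^ n - 1 :=
  mul_geom_sum q n

theorem pow_mul_qint_inv (n : ℕ) {q : ℂ} (hq : q ≠ 0) :
    q ^ n * qint n q⁻¹ = q * qint n q := by
  induction n with
  | zero => simp [qint]
  | succ k ih =>
    have hsucc : ∀ x : ℂ, qint (k + 1) x = qint k x + x ^ k :=
      fun x => Finset.sum_range_succ _ k
    have hk : q ^ k * q⁻¹ ^ k = 1 := by
      rw [← mul_pow, mul_inv_cancel₀ hq, one_pow]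
    have hgeom := sub_one_mul_qint k q
    rw [hsucc, hsucc]
    linear_combination q * ih + q * hk + q * hgeom

/-- Palindromicity of the discriminant of the `q`-metallic number. -/
theorem stmt_1 (n : ℕ) (hn : 0 < n) (q : ℂ) (hq : q ≠ 0) :
    q ^ (2 * n + 2) * Dmet n (1 / q) = Dmet n q := by
  have hinv : q * q⁻¹ = 1 := mul_inv_cancel₀ hq
  have hpow : q ^ n * q⁻¹ ^ n = 1 := by
    rw [← mul_pow, hinv, one_pow]
  have hqint := pow_mul_qint_inv n hq
  have hgeom := sub_one_mul_qint n q
  have hroot : q ^ (n + 1) * ((q⁻¹ - 1) * (q⁻¹ ^ n + 1) + q⁻¹ * qint n q⁻¹) =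
      q * qint n q - (q - 1) * (q ^ n + 1) := by
    have hlin : q * (q⁻¹ - 1) = 1 - q := by linear_combination hinv
    have hconst : q ^ n * (q⁻¹ ^ n + 1) = 1 + q ^ n := by linear_combination hpow
    calc _ = (q * (q⁻¹ - 1)) * (q ^ n * (q⁻¹ ^ n + 1)) +
          (q * q⁻¹) * (q ^ n * qint n q⁻¹) := by ring
      _ = _ := by rw [hlin, hconst, hinv, hqint]; ring
  rw [one_div, Dmet, Dmet]
  calc _ = (q ^ (n + 1) * ((q⁻¹ - 1) * (q⁻¹ ^ n + 1) + q⁻¹ * qint n q⁻¹)) ^ 2 +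
        4 * q ^ (2 * n + 1) * (q * q⁻¹) := by ring
    _ = _ := by
      rw [hroot, hinv]
      linear_combination -4 * q * (q ^ n + 1) * hgeom
end

section
/- For every positive integer n and every complex number q, the discriminant of the q-metallic number factors as D_n(q) = (1 - q + q^2) * P_n(q). -/
/-- The polynomial `P_n(q) = 1 + q [n]_q^2 + 2 q^n + q^{2n}`. -/
noncomputable def Pmet (n : ℕ) (q : ℂ) : ℂ :=
  1 + q * (qint n q) ^ 2 + 2 * q ^ n + q ^ (2 * n)

/-- Factorization of the discriminant: `D_n(q) = (1 - q + q^2) P_n(q)`. -/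
theorem stmt_2 (n : ℕ) (hn : 0 < n) (q : ℂ) :
    Dmet n q = (1 - q + q ^ 2) * Pmet n q := by
  have h : q ^ n = 1 + (q - 1) * qint n q := by
    rw [qint, mul_geom_sum]
    ring
  rw [Dmet, Pmet, mul_comm 2 n, pow_mul, h]
  ring
end

section
/- Let n >= 3 be an integer and r > 5/2 a real number. Define mu_0 = 1, mu_t = t*r^t for 0 < t < n, mu_n = (n+2)*r^n, mu_t = (2n-t)*r^t for n < t < 2n, and mu_{2n} = r^{2n}. Then mu_t > 0 for all 0 <= t <= 2n, the sequence (mu_t)_{t=0}^{2n} is strictly increasing, and mu_{2n-1} < (2/5)*mu_{2n}. -/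
/-- For `n ≥ 3` and `r > 5/2`, the sequence `μ_0 = 1`, `μ_t = t r^t` for `0 < t < n`,
`μ_n = (n+2) r^n`, `μ_t = (2n-t) r^t` for `n < t < 2n`, `μ_{2n} = r^{2n}` consists of
positive terms, is strictly increasing, and satisfies `μ_{2n-1} < (2/5) μ_{2n}`. -/
theorem stmt_3 (n : ℕ) (hn : 3 ≤ n) (r : ℝ) (hr : 5 / 2 < r)
    (μ : ℕ → ℝ)
    (h0 : μ 0 = 1)
    (h1 : ∀ t, 0 < t → t < n → μ t = (t : ℝ) * r ^ t)
    (h2 : μ n = ((n : ℝ) + 2) * r ^ n)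
    (h3 : ∀ t, n < t → t < 2 * n → μ t = (2 * (n : ℝ) - (t : ℝ)) * r ^ t)
    (h4 : μ (2 * n) = r ^ (2 * n)) :
    (∀ t, t ≤ 2 * n → 0 < μ t) ∧
    (∀ s t, s < t → t ≤ 2 * n → μ s < μ t) ∧
    μ (2 * n - 1) < (2 / 5) * μ (2 * n) := by
  have hpow : ∀ t : ℕ, 0 < r ^ t := fun t => pow_pos (by linarith) t
  have hn' : (3 : ℝ) ≤ n := by exact_mod_cast hn
  have compare : ∀ (a b : ℝ) (t : ℕ), a < b * r → a * r ^ t < b * r ^ (t + 1) := by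
    intro a b t h
    have := mul_lt_mul_of_pos_right h (hpow t)
    rw [pow_succ]
    linarith
  have step : ∀ t, t < 2 * n → μ t < μ (t + 1) := by
    intro t ht
    rcases Nat.eq_zero_or_pos t with rfl | ht0
    · rw [h0, h1 (0 + 1) (by omega) (by omega)]
      norm_num
      linarith
    have ht0' : (1 : ℝ) ≤ t := by exact_mod_cast ht0
    rcases lt_trichotomy t n with htn | rfl | htn
    · rw [h1 t ht0 htn]
      rcases (Nat.succ_le_of_lt htn).lt_or_eq with h | h
      · rw [h1 (t + 1) (by omega) h]
        apply compare
        push_cast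
        nlinarith
      · have h' : t + 1 = n := h
        have hc : (t : ℝ) + 1 = n := by exact_mod_cast h'
        rw [h', h2, ← hc, ← h']
        apply compare
        nlinarith
    · rw [h2, h3 (t + 1) (by omega) (by omega)]
      apply compare
      push_cast
      nlinarith
    · rw [h3 t htn ht]
      rcases (Nat.succ_le_of_lt ht).lt_or_eq with h | h
      · have hc : (t : ℝ) + 2 ≤ 2 * n := by exact_mod_cast h
        rw [h3 (t + 1) (by omega) h]
        apply compare
        push_cast
        nlinarith
      · have h' : t + 1 = 2 * n := h
        have hc : (t : ℝ) + 1 = 2 * n := by exact_mod_cast h'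
        rw [h', h4, ← h', ← hc, ← one_mul (r ^ (t + 1))]
        apply compare
        linarith
  have mono : ∀ s t, s < t → t ≤ 2 * n → μ s < μ t := by
    intro s t hst
    induction t, hst using Nat.le_induction with
    | base => exact fun h => step s h
    | succ t _ ih => exact fun h => (ih (by omega)).trans (step t h)
  refine ⟨fun t ht => ?_, mono, ?_⟩
  · rcases Nat.eq_zero_or_pos t with rfl | ht0
    · rw [h0]
      exact one_pos
    · have := mono 0 t ht0 ht
      rw [h0] at this
      linarith
  · obtain ⟨m, hm⟩ : ∃ m, 2 * n = m + 1 := ⟨2 * n - 1, by omega⟩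
    have hc : 2 * (n : ℝ) = m + 1 := by exact_mod_cast hm
    rw [h4, h3 (2 * n - 1) (by omega) (by omega), hc, hm, Nat.add_sub_cancel]
    have := compare 1 (2 / 5) m (by linarith)
    linarith
end

section
/- For every positive integer n, the sequence M_k(n) satisfies M_2(n) = [n]_q, M_3(n) = 1 + q([n]_q)^2, M_4(n) = (q^{2n} + 1)[n]_q + q([n]_q)^3, and for every k >= 1 (as functions of the complex variable q): M_{k+4}(n) = f(q,n) * M_{k+2}(n) - q^{2n} * M_k(n). -/
/-- The polynomial `f(q,n) = 1 + q [n]_q^2 + q^{2n}`. -/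
noncomputable def fmet (n : ℕ) (q : ℂ) : ℂ := 1 + q * (qint n q) ^ 2 + q ^ (2 * n)

/-- The sequence `M_k(n)`: `M_0 = 0`, `M_1 = 1`, and for `k ≥ 2`,
`M_k = [n]_q M_{k-1} + q^{2n} M_{k-2}` if `k` is even,
`M_k = q [n]_q M_{k-1} + M_{k-2}` if `k` is odd. -/
noncomputable def M (n : ℕ) : ℕ → ℂ → ℂ
  | 0 => fun _ => 0
  | 1 => fun _ => 1
  | (k + 2) => fun q =>
      if (k + 2) % 2 = 0 then
        qint n q * M n (k + 1) q + q ^ (2 * n) * M n k q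
      else
        q * qint n q * M n (k + 1) q + M n k q

/-- The recurrence for `M` at even indices. -/
theorem M_add_two_of_even (n : ℕ) {k : ℕ} (hk : Even k) (q : ℂ) :
    M n (k + 2) q = qint n q * M n (k + 1) q + q ^ (2 * n) * M n k q := by
  rw [M]
  exact if_pos (by grind)

/-- The recurrence for `M` at odd indices. -/
theorem M_add_two_of_odd (n : ℕ) {k : ℕ} (hk : Odd k) (q : ℂ) :
    M n (k + 2) q = q * qint n q * M n (k + 1) q + M n k q := by
  rw [M]
  exact if_neg (by grind)

/-- The parity-free recurrence for `M`, valid also at `k = 0`. -/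
theorem M_add_four (n k : ℕ) (q : ℂ) :
    M n (k + 4) q = fmet n q * M n (k + 2) q - q ^ (2 * n) * M n k q := by
  rcases Nat.even_or_odd k with hk | hk
  · have h2 := M_add_two_of_even n hk q
    have h3 := M_add_two_of_odd n hk.add_one q
    have h4 := M_add_two_of_even n (hk.add even_two) q
    rw [fmet]
    linear_combination h4 + qint n q * h3 - h2
  · have h2 := M_add_two_of_odd n hk q
    have h3 := M_add_two_of_even n hk.add_one q
    have h4 := M_add_two_of_odd n (hk.add_even even_two) q
    rw [fmet]
    linear_combination h4 + q * qint n q * h3 - q ^ (2 * n) * h2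

/-- Initial values of `M_k(n)` and the recurrence
`M_{k+4} = f(q,n) M_{k+2} - q^{2n} M_k` for `k ≥ 1`. -/
theorem stmt_7 (n : ℕ) (hn : 0 < n) (q : ℂ) :
    M n 2 q = qint n q ∧
    M n 3 q = 1 + q * (qint n q) ^ 2 ∧
    M n 4 q = (q ^ (2 * n) + 1) * qint n q + q * (qint n q) ^ 3 ∧
    (∀ k, 1 ≤ k → M n (k + 4) q = fmet n q * M n (k + 2) q - q ^ (2 * n) * M n k q) := by
  have h2 : M n 2 q = qint n q := by simp [M]
  have h3 : M n 3 q = 1 + q * (qint n q) ^ 2 := by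
    rw [M_add_two_of_odd n odd_one, h2, M]
    ring
  refine ⟨h2, h3, ?_, fun k _ => M_add_four n k q⟩
  rw [M_add_two_of_even n even_two, h3, h2]
  ring
end

section
/- For every positive integer n and every k >= 2 (as functions of the complex variable q): M~_{k+4}(n) = f(q,n) * M~_{k+2}(n) - q^{2n} * M~_k(n). -/
/-- The sequence `M~_k(n)`: `M~_0 = 0`, `M~_1 = 1`, `M~_2 = [n]_q`,
`M~_3 = [n]_q^2 + q^{2n-1}`, and for `k ≥ 4`,
`M~_k = q [n]_q M~_{k-1} + M~_{k-2}` if `k` is even,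
`M~_k = [n]_q M~_{k-1} + q^{2n} M~_{k-2}` if `k` is odd. -/
noncomputable def Mt (n : ℕ) : ℕ → ℂ → ℂ
  | 0 => fun _ => 0
  | 1 => fun _ => 1
  | 2 => fun q => qint n q
  | 3 => fun q => (qint n q) ^ 2 + q ^ (2 * n - 1)
  | (k + 4) => fun q =>
      if (k + 4) % 2 = 0 then
        q * qint n q * Mt n (k + 3) q + Mt n (k + 2) q
      else
        qint n q * Mt n (k + 3) q + q ^ (2 * n) * Mt n (k + 2) q

theorem Mt_add_four_of_even (n : ℕ) (q : ℂ) {k : ℕ} (hk : k % 2 = 0) :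
    Mt n (k + 4) q = q * qint n q * Mt n (k + 3) q + Mt n (k + 2) q := by
  rw [Mt]
  exact if_pos (by omega)

theorem Mt_add_four_of_odd (n : ℕ) (q : ℂ) {k : ℕ} (hk : k % 2 = 1) :
    Mt n (k + 4) q = qint n q * Mt n (k + 3) q + q ^ (2 * n) * Mt n (k + 2) q := by
  rw [Mt]
  exact if_neg (by omega)

/-- The recurrence `M~_{k+4} = f(q,n) M~_{k+2} - q^{2n} M~_k` for `k ≥ 2`. -/
theorem stmt_8 (n : ℕ) (hn : 0 < n) (q : ℂ) :
    ∀ k, 2 ≤ k → Mt n (k + 4) q = fmet n q * Mt n (k + 2) q - q ^ (2 * n) * Mt n k q := by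
  intro k hk
  obtain ⟨j, rfl⟩ := Nat.exists_eq_add_of_le' hk
  rw [fmet]
  rcases Nat.mod_two_eq_zero_or_one j with h | h
  · have h₀ := Mt_add_four_of_even n q h
    have h₁ := Mt_add_four_of_odd n q (k := j + 1) (by omega)
    have h₂ := Mt_add_four_of_even n q (k := j + 2) (by omega)
    linear_combination h₂ + q * qint n q * h₁ - q ^ (2 * n) * h₀
  · have h₀ := Mt_add_four_of_odd n q h
    have h₁ := Mt_add_four_of_even n q (k := j + 1) (by omega)
    have h₂ := Mt_add_four_of_odd n q (k := j + 2) (by omega)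
    linear_combination h₂ + qint n q * h₁ - h₀
end

section
/- Let n and m be positive integers and let q be a positive real number. Define the finite q-continued fraction [n,n,...,n]_q with 2m entries by the backward recursion y_{2m} = [n]_{q^{-1}}, and for i from 2m-1 down to 1: y_i = [n]_q + q^n / y_{i+1} if i is odd, and y_i = [n]_{q^{-1}} + q^{-n} / y_{i+1} if i is even (all y_i are well-defined positive reals). Then M_{2m}(n)(q) != 0 and y_1 = M~_{2m+1}(n)(q) / M_{2m}(n)(q). -/
/-- The Euler `q`-integer `[n]_q = 1 + q + ⋯ + q^{n-1}` (real variable). -/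
noncomputable def qintR (n : ℕ) (q : ℝ) : ℝ := ∑ i ∈ Finset.range n, q ^ i

theorem qintR_pos {n : ℕ} (hn : 0 < n) {q : ℝ} (hq : 0 < q) : 0 < qintR n q :=
  Finset.sum_pos (fun i _ => pow_pos hq i) ⟨0, Finset.mem_range.2 hn⟩

theorem qint_ofReal (n : ℕ) (q : ℝ) : qint n (q : ℂ) = (qintR n q : ℂ) := by
  simp [qint, qintR]

theorem pow_mul_qintR_inv (n : ℕ) {q : ℝ} (hq : 0 < q) :
    q ^ n * qintR n q⁻¹ = q * qintR n q := by
  unfold qintR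
  rw [← Finset.sum_range_reflect (fun i => q ^ i), Finset.mul_sum, Finset.mul_sum]
  refine Finset.sum_congr rfl fun i hi => ?_
  have hi' := Finset.mem_range.1 hi
  rw [← pow_succ', show n - 1 - i + 1 = n - i by omega, pow_sub₀ q hq.ne' hi'.le, inv_pow]

theorem M_one (n : ℕ) (q : ℂ) : M n 1 q = 1 := by
  simp [M]

theorem M_two (n : ℕ) (q : ℂ) : M n 2 q = qint n q := by
  simp [M]

theorem M_even (n k : ℕ) (q : ℂ) :
    M n (2 * k + 2) q = qint n q * M n (2 * k + 1) q + q ^ (2 * n) * M n (2 * k) q := by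
  rw [M]
  exact if_pos (by omega)

theorem M_odd (n k : ℕ) (q : ℂ) :
    M n (2 * k + 3) q = q * qint n q * M n (2 * k + 2) q + M n (2 * k + 1) q := by
  rw [M]
  exact if_neg (by omega)

theorem Mt_even (n k : ℕ) (q : ℂ) :
    Mt n (2 * k + 4) q = q * qint n q * Mt n (2 * k + 3) q + Mt n (2 * k + 2) q := by
  rw [Mt]
  exact if_pos (by omega)

theorem Mt_odd (n k : ℕ) (q : ℂ) :
    Mt n (2 * k + 5) q =
      qint n q * Mt n (2 * k + 4) q + q ^ (2 * n) * Mt n (2 * k + 3) q := by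
  rw [show 2 * k + 5 = (2 * k + 1) + 4 by ring, Mt]
  exact if_neg (by omega)

/-- The two sequences agree at positive even indices; the second component relates their
values at odd indices. -/
theorem Mt_eq_M_even_and_odd {n : ℕ} (hn : 0 < n) (q : ℂ) (k : ℕ) :
    Mt n (2 * k + 2) q = M n (2 * k + 2) q ∧
    q * qint n q * Mt n (2 * k + 3) q =
      qint n q * M n (2 * k + 3) q + (q ^ (2 * n) - 1) * M n (2 * k + 2) q := by
  induction k with
  | zero =>
    have hpow : q * q ^ (2 * n - 1) = q ^ (2 * n) := by
      rw [← pow_succ', show 2 * n - 1 + 1 = 2 * n by omega]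
    refine ⟨by simp [Mt, M], ?_⟩
    rw [M_odd]
    simp only [mul_zero, zero_add, M_one, M_two, Mt]
    linear_combination qint n q * hpow
  | succ k ih =>
    obtain ⟨he, ho⟩ := ih
    have hM := M_even n (k + 1) q
    have hM' := M_odd n (k + 1) q
    have hT := Mt_even n k q
    have hT' := Mt_odd n k q
    simp only [mul_add, mul_one, add_assoc, Nat.reduceAdd] at *
    have h : Mt n (2 * k + 4) q = M n (2 * k + 4) q := by
      linear_combination hT - hM + ho + he
    refine ⟨h, ?_⟩
    rw [hT', hM', h]
    linear_combination q ^ (2 * n) * ho - (q ^ (2 * n) - 1) * hM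

theorem M_even_succ {n : ℕ} (hn : 0 < n) (q : ℂ) (k : ℕ) :
    M n (2 * k + 4) q = q * qint n q * Mt n (2 * k + 3) q + M n (2 * k + 2) q := by
  rw [← (Mt_eq_M_even_and_odd hn q k).1, ← Mt_even]
  exact (Mt_eq_M_even_and_odd hn q (k + 1)).1.symm

theorem Mt_odd_succ {n : ℕ} (hn : 0 < n) (q : ℂ) (k : ℕ) :
    Mt n (2 * k + 5) q =
      (q * qint n q ^ 2 + q ^ (2 * n)) * Mt n (2 * k + 3) q +
        qint n q * M n (2 * k + 2) q := by
  rw [Mt_odd, Mt_even, (Mt_eq_M_even_and_odd hn q k).1]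
  ring

/-- Two steps of the continued fraction act as a fractional linear map. -/
theorem qfraction_two_steps {n : ℕ} (hn : 0 < n) {q : ℝ} (hq : 0 < q) {p r : ℝ}
    (hp : 0 < p) (hr : 0 < r) :
    qintR n q + q ^ n / (qintR n q⁻¹ + q⁻¹ ^ n / (p / r)) =
      ((q * qintR n q ^ 2 + q ^ (2 * n)) * p + qintR n q * r) /
        (q * qintR n q * p + r) := by
  have ha := qintR_pos hn hq
  have hqn := pow_pos hq n
  have hb : qintR n q⁻¹ = q * qintR n q / q ^ n := by
    rw [← pow_mul_qintR_inv n hq]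
    field_simp
  have hden : 0 < q * qintR n q * p + r := by positivity
  have hinner : qintR n q⁻¹ + q⁻¹ ^ n / (p / r) =
      (q * qintR n q * p + r) / (q ^ n * p) := by
    rw [hb, inv_pow]
    field_simp
  rw [hinner]
  field_simp
  ring

/-- The value of the `q`-continued fraction, with positive real numerator and denominator. -/
theorem qfraction_eq_div {n : ℕ} (hn : 0 < n) {q : ℝ} (hq : 0 < q) (k : ℕ) (y : ℕ → ℝ)
    (hlast : y (2 * k + 2) = qintR n q⁻¹)
    (hrec : ∀ i, 1 ≤ i → i < 2 * k + 2 →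
      y i = if i % 2 = 1 then qintR n q + q ^ n / y (i + 1)
            else qintR n q⁻¹ + q⁻¹ ^ n / y (i + 1)) :
    ∃ p r : ℝ, 0 < p ∧ 0 < r ∧ Mt n (2 * k + 3) (q : ℂ) = p ∧
      M n (2 * k + 2) (q : ℂ) = r ∧ y 1 = p / r := by
  have ha := qintR_pos hn hq
  induction k generalizing y with
  | zero =>
    refine ⟨qintR n q ^ 2 + q ^ (2 * n - 1), qintR n q, by positivity, ha, ?_, ?_, ?_⟩
    · simp [Mt, qint_ofReal]
    · simp [M_two, qint_ofReal]
    · have hb := pow_mul_qintR_inv n hq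
      have hb0 := qintR_pos hn (inv_pos.2 hq)
      have hpow : q * q ^ (2 * n - 1) = q ^ n * q ^ n := by
        rw [← pow_succ', ← pow_add]
        congr 1
        omega
      have h1 := hrec 1 le_rfl (by norm_num)
      norm_num at h1 hlast
      rw [h1, hlast, eq_div_iff ha.ne', add_mul, ← sq, div_mul_eq_mul_div, add_right_inj,
        div_eq_iff hb0.ne']
      refine mul_left_cancel₀ hq.ne' ?_
      linear_combination -q ^ n * hb - qintR n q⁻¹ * hpow
  | succ k ih =>
    obtain ⟨p, r, hp, hr, hMt, hM, hy⟩ := ih (fun i => y (i + 2)) hlast fun i hi hi' => by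
      have h := hrec (i + 2) (by omega) (by omega)
      rwa [Nat.add_mod_right] at h
    refine ⟨(q * qintR n q ^ 2 + q ^ (2 * n)) * p + qintR n q * r,
      q * qintR n q * p + r, by positivity, by positivity, ?_, ?_, ?_⟩
    · rw [show 2 * (k + 1) + 3 = 2 * k + 5 by ring, Mt_odd_succ hn, hMt, hM, qint_ofReal]
      push_cast
      rfl
    · rw [show 2 * (k + 1) + 2 = 2 * k + 4 by ring, M_even_succ hn, hMt, hM, qint_ofReal]
      push_cast
      rfl
    · have h1 := hrec 1 le_rfl (by omega)
      have h2 := hrec 2 (by omega) (by omega)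
      norm_num at h1 h2 hy
      rw [h1, h2, hy, ← inv_pow, qfraction_two_steps hn hq hp hr]

theorem qfraction_pos {n N : ℕ} (hn : 0 < n) {q : ℝ} (hq : 0 < q) (y : ℕ → ℝ)
    (hlast : y N = qintR n q⁻¹)
    (hrec : ∀ i, 1 ≤ i → i < N →
      y i = if i % 2 = 1 then qintR n q + q ^ n / y (i + 1)
            else qintR n q⁻¹ + q⁻¹ ^ n / y (i + 1))
    {i : ℕ} (hi : 1 ≤ i) (hiN : i ≤ N) : 0 < y i := by
  have ha := qintR_pos hn hq
  have hb := qintR_pos hn (inv_pos.2 hq)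
  induction hiN using Nat.decreasingInduction with
  | self => rwa [hlast]
  | of_succ k hk ih =>
    have hy := ih (by omega)
    rw [hrec k hi hk]
    split_ifs <;> positivity

/-- For positive integers `n, m` and a positive real `q`, the finite
`q`-continued fraction `[n, n, …, n]_q` with `2m` entries, computed by the
backward recursion `y_{2m} = [n]_{q⁻¹}`,
`y_i = [n]_q + qⁿ / y_{i+1}` for odd `i` and
`y_i = [n]_{q⁻¹} + q⁻ⁿ / y_{i+1}` for even `i` (`1 ≤ i < 2m`),
has well-defined positive values and satisfies
`y_1 = M~_{2m+1}(n)(q) / M_{2m}(n)(q)` with `M_{2m}(n)(q) ≠ 0`. -/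
theorem stmt_19 (n m : ℕ) (hn : 0 < n) (hm : 0 < m) (q : ℝ) (hq : 0 < q)
    (y : ℕ → ℝ)
    (hlast : y (2 * m) = qintR n q⁻¹)
    (hrec : ∀ i, 1 ≤ i → i < 2 * m →
      y i = if i % 2 = 1 then qintR n q + q ^ n / y (i + 1)
            else qintR n q⁻¹ + q⁻¹ ^ n / y (i + 1)) :
    (∀ i, 1 ≤ i → i ≤ 2 * m → 0 < y i) ∧
    M n (2 * m) (q : ℂ) ≠ 0 ∧
    (y 1 : ℂ) = Mt n (2 * m + 1) (q : ℂ) / M n (2 * m) (q : ℂ) := by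
  obtain ⟨k, rfl⟩ : ∃ k, m = k + 1 := ⟨m - 1, by omega⟩
  obtain ⟨p, r, _, hr, hMt, hM, hy⟩ := qfraction_eq_div hn hq k y hlast hrec
  have hM' : M n (2 * (k + 1)) (q : ℂ) = r := hM
  have hMt' : Mt n (2 * (k + 1) + 1) (q : ℂ) = p := hMt
  refine ⟨fun i hi hi' => qfraction_pos hn hq y hlast hrec hi hi', ?_, ?_⟩
  · rw [hM']
    exact_mod_cast hr.ne'
  · rw [hM', hMt', hy]
    push_cast
    rfl
end
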